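/- Let A = {a, b, c} with positive integers a < b < c. Then w^A(n) = w^A(n + b + c) holds for all n ≥ 0 (equivalently, per(A) divides b + c and preper(A) = 0) if and only if w^A(b + c − i) = 1 for every i ∈ {1, …, a}. -/

import Mathlib

open Classical in
/-- The winning sequence on ℕ, where `seed` gives values at negative positions. -/
noncomputable def subW (A : Set ℕ) (seed : ℤ → ℕ) : ℕ → ℕ := fun n =>
  Nat.strongRecOn n (fun n ih =>
    if ∃ x ∈ A, (if h : 0 < x ∧ x ≤ n then ih (n - x) (by omega)
                 else seed ((n : ℤ) - (x : ℤ))) = 0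
    then 1 else 0)

/-- The winning sequence `w^{A,seed} : ℤ → ℕ`. -/
noncomputable def W (A : Set ℕ) (seed : ℤ → ℕ) : ℤ → ℕ := fun n =>
  if 0 ≤ n then subW A seed n.toNat else seed n

/-- The trivial seed (all ones), giving the unseeded sequence `w^A`. -/
def one : ℤ → ℕ := fun _ => 1

/-- The seed function determined by a string `S ∈ {0,1}^L`: `w(-i) = S_i` for `1 ≤ i ≤ L`,
and `w(n) = 1` for `n < -L`. -/
def seedExt (L : ℕ) (S : ℕ → Bool) : ℤ → ℕ := fun j =>
  if -(L : ℤ) ≤ j ∧ j < 0 then (if S ((-j).toNat - 1) then 1 else 0) else 1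

/-- `w` is eventually periodic over `p`. -/
def PeriodicOver (w : ℤ → ℕ) (p : ℕ) : Prop :=
  ∃ N : ℕ, ∀ n : ℤ, (N : ℤ) ≤ n → w n = w (n + p)

/-- The (eventual) period: the least `p ≥ 1` over which `w` is eventually periodic. -/
noncomputable def per (w : ℤ → ℕ) : ℕ := sInf {p : ℕ | 0 < p ∧ PeriodicOver w p}

/-- The preperiod: the least `N` that works for `p = per w`. -/
noncomputable def preper (w : ℤ → ℕ) : ℕ :=
  sInf {N : ℕ | ∀ n : ℤ, (N : ℤ) ≤ n → w n = w (n + per w)}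

open Classical in
theorem subW_eq (A : Set ℕ) (hA : ∀ x ∈ A, 0 < x) (seed : ℤ → ℕ) (n : ℕ) :
    subW A seed n = if ∃ x ∈ A, W A seed ((n : ℤ) - x) = 0 then 1 else 0 := by
  rw [subW, Nat.strongRecOn_eq]
  refine if_congr (exists_congr fun x => and_congr_right fun hx => ?_) rfl rfl
  have hx0 := hA x hx
  by_cases hxn : x ≤ n
  · have h : 0 ≤ (n : ℤ) - x := by omega
    have ht : ((n : ℤ) - x).toNat = n - x := by omega
    rw [dif_pos ⟨hx0, hxn⟩, W, if_pos h, ht, subW]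
  · have h : ¬ 0 ≤ (n : ℤ) - x := by omega
    rw [dif_neg (fun h' => hxn h'.2), W, if_neg h]

open Classical in
theorem W_of_nonneg (A : Set ℕ) (hA : ∀ x ∈ A, 0 < x) (seed : ℤ → ℕ) {n : ℤ} (hn : 0 ≤ n) :
    W A seed n = if ∃ x ∈ A, W A seed (n - x) = 0 then 1 else 0 := by
  lift n to ℕ using hn
  rw [← subW_eq A hA seed n]
  simp [W]

theorem W_one_of_neg (A : Set ℕ) {n : ℤ} (hn : n < 0) : W A one n = 1 := by
  rw [W, if_neg (by omega), one]

theorem W_one_eq_zero_or_one (A : Set ℕ) (hA : ∀ x ∈ A, 0 < x) (n : ℤ) :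
    W A one n = 0 ∨ W A one n = 1 := by
  rcases lt_or_ge n 0 with hn | hn
  · exact Or.inr (W_one_of_neg A hn)
  · rw [W_of_nonneg A hA one hn]
    split_ifs <;> simp

theorem W_one_triple_eq_one_iff {a b c : ℕ} (ha : 0 < a) (hb : 0 < b) (hc : 0 < c)
    {n : ℤ} (hn : 0 ≤ n) :
    W {a, b, c} one n = 1 ↔ W {a, b, c} one (n - a) = 0 ∨ W {a, b, c} one (n - b) = 0 ∨
      W {a, b, c} one (n - c) = 0 := by
  classical
  rw [W_of_nonneg {a, b, c} (by simp [ha, hb, hc]) one hn]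
  simp only [Set.mem_insert_iff, Set.mem_singleton_iff, exists_eq_or_imp, exists_eq_left,
    ite_eq_left_iff, zero_ne_one, imp_false, not_not]

/-- for `A = {a,b,c}` with `a < b < c`, pure periodicity over `b + c`
holds iff `w^A(b + c - i) = 1` for all `i ∈ {1, …, a}`. -/
theorem stmt_8 (a b c : ℕ) (ha : 0 < a) (hab : a < b) (hbc : b < c) :
    (∀ n : ℤ, 0 ≤ n →
        W {a, b, c} one n = W {a, b, c} one (n + b + c)) ↔
    (∀ i : ℕ, 1 ≤ i → i ≤ a → W {a, b, c} one ((b : ℤ) + c - i) = 1) := by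
  have hb : 0 < b := by omega
  have hc : 0 < c := by omega
  have h01 := W_one_eq_zero_or_one {a, b, c} (by simp [ha, hb, hc])
  have hneg : ∀ n : ℤ, n < 0 → W {a, b, c} one n = 1 := fun n => W_one_of_neg {a, b, c}
  have hrec : ∀ n : ℤ, 0 ≤ n → _ := fun n => W_one_triple_eq_one_iff (n := n) ha hb hc
  generalize W {a, b, c} one = w at *
  constructor
  · intro hper i hi hia
    have hzero : w ((a : ℤ) - i) = 0 := by
      have := hrec ((a : ℤ) - i) (by omega)
      have := hneg ((a : ℤ) - i - a) (by omega)
      have := hneg ((a : ℤ) - i - b) (by omega)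
      have := hneg ((a : ℤ) - i - c) (by omega)
      have := h01 ((a : ℤ) - i)
      omega
    have hshift := hper ((a : ℤ) - i) (by omega)
    have hstep := hrec ((a : ℤ) - i + b + c) (by omega)
    rw [show (a : ℤ) - i + b + c - a = b + c - i by ring] at hstep
    have := h01 ((b : ℤ) + c - i)
    omega
  · intro hlast n hn
    lift n to ℕ using hn
    induction n using Nat.strong_induction_on with
    | _ n ih =>
      have hshift : ∀ x : ℕ, 0 < x → x ≤ n → w ((n : ℤ) - x) = w ((n : ℤ) - x + b + c) := by
        intro x hx hxn
        have := ih (n - x) (by omega)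
        rwa [Nat.cast_sub hxn] at this
      have hP := hrec ((n : ℤ) + b + c) (by omega)
      have hB := hrec ((n : ℤ) + b) (by omega)
      have hC := hrec ((n : ℤ) + c) (by omega)
      have hN := hrec (n : ℤ) (by omega)
      rw [show (n : ℤ) + b + c - a = n - a + b + c by ring,
        show (n : ℤ) + b + c - b = n + c by ring,
        show (n : ℤ) + b + c - c = n + b by ring] at hP
      rw [show (n : ℤ) + b - b = n by ring] at hB
      rw [show (n : ℤ) + c - c = n by ring] at hC
      have hA : w ((n : ℤ) - a) = w ((n : ℤ) - a + b + c) := by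
        rcases le_or_gt a n with han | han
        · exact hshift a ha han
        · have := hlast (a - n) (by omega) (by omega)
          rw [Nat.cast_sub han.le, show (b : ℤ) + c - (a - n) = n - a + b + c by ring] at this
          rw [hneg _ (by omega), this]
      have hbc' : w ((n : ℤ) - b) = 0 → w ((n : ℤ) + c) = 0 := by
        intro h
        have hbn : b ≤ n := by
          by_contra hlt
          have := hneg ((n : ℤ) - b) (by omega)
          omega
        rw [← h, hshift b hb hbn]
        congr 1
        ring
      have hcb : w ((n : ℤ) - c) = 0 → w ((n : ℤ) + b) = 0 := by
        intro h
        have hcn : c ≤ n := by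
          by_contra hlt
          have := hneg ((n : ℤ) - c) (by omega)
          omega
        rw [← h, hshift c hc hcn]
        congr 1
        ring
      have := h01 n
      have := h01 ((n : ℤ) + b + c)
      grind
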